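/- Let k ≥ 2 be an integer (not necessarily even) and let m be an integer with 1 ≤ m ≤ ⌊(k+1)/6⌋. Then h_k(1/2 + i·t_m) is a nonzero real number whose sign is (−1)^m, i.e., it is strictly negative when m is odd and strictly positive when m is even, where t_m := (1/2)·cot(mπ/(k+1)). -/

import Mathlib

/-- The function `h_k(z) = ∑_{n≥1} n^k qⁿ/(1-qⁿ)² = ∑_{n≥1} n σ_{k-1}(n) qⁿ`,
`q = exp(2πiz)`, given here by its Fourier expansion. -/
noncomputable def hfun (k : ℕ) (z : ℂ) : ℂ :=
  ∑' n : ℕ, (n : ℂ) * (∑ d ∈ n.divisors, (d : ℂ) ^ (k - 1)) *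
    Complex.exp (2 * Real.pi * Complex.I * z) ^ n

open Finset

theorem tsum_pow_mul_exp_le {k : ℕ} (hk : 1 ≤ k) {s : ℝ} (hs : 0 < s) :
    ∑' a : ℕ, (a : ℝ) ^ k * Real.exp (-s) ^ a
      ≤ Real.exp 1 * (k + 1) * (k.factorial / s ^ (k + 1)) := by
  have hk0 : (0 : ℝ) < k := by exact_mod_cast hk
  set l : ℝ := s * k / (k + 1) with hl
  have hl0 : 0 < l := by positivity
  set u : ℝ := s / (k + 1) with hu
  have hu0 : 0 < u := by positivity
  have hlu : l = s - u := by rw [hl, hu]; field_simp; ring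
  have hsum : Summable fun a : ℕ => (a : ℝ) ^ k * Real.exp (-s) ^ a :=
    summable_pow_mul_geometric_of_norm_lt_one k (by simpa using hs)
  have hr1 : Real.exp (-u) < 1 := by simpa using hu0
  have hgeo := (hasSum_geometric_of_lt_one (Real.exp_pos (-u)).le hr1).mul_left
    (k.factorial / l ^ k * Real.exp (-u))
  have hterm : ∀ a : ℕ, ((a + 1 : ℕ) : ℝ) ^ k * Real.exp (-s) ^ (a + 1)
      ≤ k.factorial / l ^ k * Real.exp (-u) * Real.exp (-u) ^ a := by
    intro a
    have h1 := Real.pow_div_factorial_le_exp (x := l * (a + 1 : ℕ)) (by positivity) k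
    rw [div_le_iff₀ (by positivity), mul_pow] at h1
    have h2 : ((a + 1 : ℕ) : ℝ) ^ k ≤ k.factorial / l ^ k * Real.exp (l * (a + 1 : ℕ)) := by
      rw [div_mul_eq_mul_div, le_div_iff₀ (by positivity)]
      linarith
    calc _ ≤ k.factorial / l ^ k * Real.exp (l * (a + 1 : ℕ)) * Real.exp (-s) ^ (a + 1) := by
          gcongr
      _ = _ := by
          rw [mul_assoc, mul_assoc, ← pow_succ', ← Real.exp_nat_mul, ← Real.exp_nat_mul,
            ← Real.exp_add, hlu]
          congr 2; ring
  rw [hsum.tsum_eq_zero_add]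
  have h3 : ∑' a : ℕ, ((a + 1 : ℕ) : ℝ) ^ k * Real.exp (-s) ^ (a + 1)
      ≤ k.factorial / l ^ k * Real.exp (-u) * (1 - Real.exp (-u))⁻¹ :=
    hasSum_le hterm ((summable_nat_add_iff 1).2 hsum).hasSum hgeo
  have h4 : Real.exp (-u) * (1 - Real.exp (-u))⁻¹ ≤ 1 / u := by
    rw [← div_eq_mul_inv, div_le_div_iff₀ (by linarith) hu0]
    have := Real.add_one_le_exp u
    have h5 : Real.exp (-u) * Real.exp u = 1 := by rw [← Real.exp_add]; simp
    nlinarith [Real.exp_pos (-u)]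
  have h6 : ((k + 1 : ℝ) / k) ^ k ≤ Real.exp 1 := by
    calc ((k + 1 : ℝ) / k) ^ k ≤ Real.exp (1 / k) ^ k := by
          gcongr
          have := Real.add_one_le_exp (1 / (k : ℝ))
          rw [add_div, div_self hk0.ne']; linarith
      _ = _ := by rw [← Real.exp_nat_mul]; congr 1; field_simp
  have h0 : ((0 : ℕ) : ℝ) ^ k * Real.exp (-s) ^ 0 = 0 := by simp; omega
  rw [h0, zero_add]
  calc _ ≤ _ := h3
    _ ≤ k.factorial / l ^ k * (1 / u) := by rw [mul_assoc]; gcongr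
    _ = ((k + 1 : ℝ) / k) ^ k * (k + 1) * (k.factorial / s ^ (k + 1)) := by
        rw [hl, hu, div_pow, div_pow, mul_pow, pow_succ]; field_simp
    _ ≤ _ := by gcongr

theorem summable_mul_pow_mul_pow_mul {q : ℝ} (hq : |q| < 1) (k : ℕ) :
    Summable fun c : ℕ+ × ℕ+ => (c.1 : ℝ) * (c.2 : ℝ) ^ k * q ^ (c.1 * c.2 : ℕ) := by
  have hr1 : √|q| < 1 := by rw [Real.sqrt_lt' one_pos]; simpa using hq
  have hn : ‖√|q|‖ < 1 := by rwa [Real.norm_of_nonneg (Real.sqrt_nonneg _)]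
  have h1 : Summable fun n : ℕ+ => (n : ℝ) ^ 1 * √|q| ^ (n : ℕ) :=
    (summable_pow_mul_geometric_of_norm_lt_one 1 hn).comp_injective PNat.coe_injective
  have h2 : Summable fun n : ℕ+ => (n : ℝ) ^ k * √|q| ^ (n : ℕ) :=
    (summable_pow_mul_geometric_of_norm_lt_one k hn).comp_injective PNat.coe_injective
  refine Summable.of_norm_bounded
    (h1.mul_of_nonneg h2 (fun n => by positivity) (fun n => by positivity)) fun c => ?_
  have h3 : |q| ^ (c.1 * c.2 : ℕ) ≤ √|q| ^ (c.1 : ℕ) * √|q| ^ (c.2 : ℕ) := by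
    rw [← pow_add]
    nth_rw 1 [← Real.sq_sqrt (abs_nonneg q)]
    rw [← pow_mul]
    refine pow_le_pow_of_le_one (Real.sqrt_nonneg _) hr1.le ?_
    nlinarith [c.1.pos, c.2.pos]
  calc ‖(c.1 : ℝ) * (c.2 : ℝ) ^ k * q ^ (c.1 * c.2 : ℕ)‖
      = (c.1 : ℝ) * (c.2 : ℝ) ^ k * |q| ^ (c.1 * c.2 : ℕ) := by simp
    _ ≤ (c.1 : ℝ) * (c.2 : ℝ) ^ k * (√|q| ^ (c.1 : ℕ) * √|q| ^ (c.2 : ℕ)) := by gcongr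
    _ = _ := by ring

theorem hasSum_mul_tsum_pow_mul_pow {q : ℝ} (hq : |q| < 1) {k : ℕ} (hk : 1 ≤ k) :
    HasSum (fun d : ℕ => ((d + 1 : ℕ) : ℝ) * ∑' a : ℕ, (a : ℝ) ^ k * (q ^ (d + 1)) ^ a)
      (∑' n : ℕ, (n : ℝ) * (∑ d ∈ n.divisors, (d : ℝ) ^ (k - 1)) * q ^ n) := by
  have hs := summable_mul_pow_mul_pow_mul hq k
  have e1 : HasSum (fun d : ℕ+ => ∑' a : ℕ+, (d : ℝ) * (a : ℝ) ^ k * q ^ (d * a : ℕ))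
      (∑' c : ℕ+ × ℕ+, (c.1 : ℝ) * (c.2 : ℝ) ^ k * q ^ (c.1 * c.2 : ℕ)) := by
    rw [hs.tsum_prod]; exact hs.prod.hasSum
  have e2 : ∑' c : ℕ+ × ℕ+, (c.1 : ℝ) * (c.2 : ℝ) ^ k * q ^ (c.1 * c.2 : ℕ)
      = ∑' n : ℕ, (n : ℝ) * (∑ d ∈ n.divisors, (d : ℝ) ^ (k - 1)) * q ^ n := by
    have hs' := sigmaAntidiagonalEquivProd.summable_iff.2 hs
    rw [← sigmaAntidiagonalEquivProd.tsum_eq]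
    have := hs'.tsum_sigma
    simp only [Function.comp_def] at this
    rw [this, ← tsum_pnat_eq_tsum_of_eq_zero (by simp)]
    refine tsum_congr fun n => ?_
    have h1 : ∀ x : (n : ℕ).divisorsAntidiagonal,
        ((sigmaAntidiagonalEquivProd ⟨n, x⟩).1 : ℕ) = x.1.1 ∧
        ((sigmaAntidiagonalEquivProd ⟨n, x⟩).2 : ℕ) = x.1.2 := fun x => ⟨rfl, rfl⟩
    simp only [(h1 _).1, (h1 _).2, tsum_fintype, univ_eq_attach]
    rw [sum_attach (n : ℕ).divisorsAntidiagonal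
      (fun x : ℕ × ℕ => (x.1 : ℝ) * (x.2 : ℝ) ^ k * q ^ (x.1 * x.2)),
      Nat.sum_divisorsAntidiagonal' (fun x y : ℕ => (x : ℝ) * (y : ℝ) ^ k * q ^ (x * y)),
      mul_sum, sum_mul]
    refine sum_congr rfl fun i hi => ?_
    have hdvd := Nat.div_mul_cancel (Nat.dvd_of_mem_divisors hi)
    have hcast : ((n : ℕ) : ℝ) = ((n / i : ℕ) : ℝ) * i := by rw [← Nat.cast_mul, hdvd]
    rw [hdvd, hcast]
    obtain ⟨j, rfl⟩ : ∃ j, k = j + 1 := ⟨k - 1, by omega⟩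
    simp only [Nat.add_sub_cancel]
    ring
  rw [e2] at e1
  have e3 : ∀ d : ℕ+, ∑' a : ℕ+, (d : ℝ) * (a : ℝ) ^ k * q ^ (d * a : ℕ)
      = (d : ℝ) * ∑' a : ℕ, (a : ℝ) ^ k * (q ^ (d : ℕ)) ^ a := by
    intro d
    rw [← tsum_pnat_eq_tsum_of_eq_zero (by simp; omega), ← tsum_mul_left]
    exact tsum_congr fun a => by rw [pow_mul, mul_assoc]
  simp only [e3] at e1
  exact (hasSum_pnat_iff_hasSum_succ
    (f := fun d : ℕ => (d : ℝ) * ∑' a : ℕ, (a : ℝ) ^ k * (q ^ d) ^ a)).1 e1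

theorem abs_tsum_sub_le {s : ℝ} (hs : 0 < s) {k : ℕ} (hk : 1 ≤ k) {B : ℕ → ℝ} {b : ℝ}
    (hB : HasSum B b)
    (h : ∀ d : ℕ, ((d : ℝ) + 2) * ∑' a : ℕ, (a : ℝ) ^ k * Real.exp (-(((d : ℝ) + 2) * s)) ^ a ≤ B d) :
    |(∑' n : ℕ, (n : ℝ) * (∑ d ∈ n.divisors, (d : ℝ) ^ (k - 1)) * (-Real.exp (-s)) ^ n)
      - ∑' a : ℕ, (a : ℝ) ^ k * (-Real.exp (-s)) ^ a| ≤ b := by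
  have hq : |-Real.exp (-s)| < 1 := by simpa using hs
  have h1 := hasSum_mul_tsum_pow_mul_pow hq hk
  have h2 := (hasSum_nat_add_iff' 1).2 h1
  simp only [sum_range_one, zero_add, Nat.cast_one, one_mul, pow_one] at h2
  rw [← Real.norm_eq_abs, ← h2.tsum_eq]
  refine tsum_of_norm_bounded hB fun d => (le_trans ?_ (h d))
  have e : Real.exp (-(((d : ℝ) + 2) * s)) = |(-Real.exp (-s)) ^ (d + 1 + 1)| := by
    rw [abs_pow, abs_neg, Real.abs_exp, ← Real.exp_nat_mul]
    push_cast; congr 1; ring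
  have hlt : ‖|(-Real.exp (-s)) ^ (d + 1 + 1)|‖ < 1 := by
    rw [norm_abs_eq_norm, norm_pow]; exact pow_lt_one₀ (norm_nonneg _) hq (by omega)
  have hsum := summable_pow_mul_geometric_of_norm_lt_one k hlt
  rw [e, norm_mul]
  have e2 : ‖((d + 1 + 1 : ℕ) : ℝ)‖ = (d : ℝ) + 2 := by
    rw [Real.norm_natCast]; push_cast; ring
  rw [e2]
  gcongr
  refine tsum_of_norm_bounded hsum.hasSum fun a => ?_
  simp

theorem exp_two_pi_I_mul_half_add (c : ℝ) :
    Complex.exp (2 * Real.pi * Complex.I * (1 / 2 + (c / 2) * Complex.I))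
      = ((-Real.exp (-(Real.pi * c)) : ℝ) : ℂ) := by
  have : 2 * Real.pi * Complex.I * (1 / 2 + (c / 2) * Complex.I)
      = Real.pi * Complex.I + ((-(Real.pi * c) : ℝ) : ℂ) := by
    push_cast
    linear_combination (Real.pi * c : ℂ) * Complex.I_mul_I
  rw [this, Complex.exp_add, Complex.exp_pi_mul_I]
  push_cast
  ring

theorem hfun_half_add (k : ℕ) (c : ℝ) :
    hfun k (1 / 2 + (c / 2) * Complex.I) =
      ((∑' n : ℕ, (n : ℝ) * (∑ d ∈ n.divisors, (d : ℝ) ^ (k - 1)) *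
        (-Real.exp (-(Real.pi * c))) ^ n : ℝ) : ℂ) := by
  rw [hfun, exp_two_pi_I_mul_half_add, Complex.ofReal_tsum]
  push_cast
  rfl

/-- Logarithmic bound to the right of `1`. -/
theorem one_add_mul_exp_neg_le {x : ℝ} (hx : 0 ≤ x) :
    (1 + x) * Real.exp (-x) ≤ Real.exp (-(x ^ 2 / (2 * (1 + x)))) := by
  have h1 : 0 < 1 + x := by linarith
  have h2 := Real.self_le_sinh_iff.2 (Real.log_nonneg (by linarith : 1 ≤ 1 + x))
  rw [Real.sinh_eq, Real.exp_neg, Real.exp_log h1] at h2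
  rw [← Real.exp_log h1, ← Real.exp_add, Real.exp_le_exp, Real.exp_log h1]
  have h3 : x ^ 2 / (2 * (1 + x)) = x - ((1 + x) - (1 + x)⁻¹) / 2 := by field_simp; ring
  linarith

theorem one_sub_mul_exp_le {x : ℝ} (hx : 0 ≤ x) (hx1 : x < 1) :
    (1 - x) * Real.exp x ≤ Real.exp (-(x ^ 2 / 2)) := by
  have h1 : 0 < 1 - x := by linarith
  have h2 := Real.hasSum_pow_div_log_of_abs_lt_one (by rwa [abs_of_nonneg hx] : |x| < 1)
  have h3 := sum_le_hasSum (range 2) (fun i _ => by positivity) h2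
  norm_num [sum_range_succ] at h3
  rw [← Real.exp_log h1, ← Real.exp_add, Real.exp_le_exp]
  linarith

/-- To the right of `m`, the weight `a ^ k * exp (-s * a)` decays geometrically. -/
theorem weight_add_le {k m : ℕ} (hm : 1 ≤ m) (hk : 11 * m ^ 2 ≤ k) {s : ℝ} (hs : (k : ℝ) / m ≤ s)
    (j : ℕ) :
    ((m + j : ℕ) : ℝ) ^ k * Real.exp (-s) ^ (m + j) ≤
      (m : ℝ) ^ k * Real.exp (-s) ^ m * Real.exp (-2) ^ j := by
  have hm0 : (0 : ℝ) < m := by exact_mod_cast hm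
  have hm1 : (1 : ℝ) ≤ m := by exact_mod_cast hm
  have hk' : 11 * (m : ℝ) ^ 2 ≤ k := by exact_mod_cast hk
  rcases Nat.eq_zero_or_pos j with rfl | hj
  · simp
  have hj1 : (1 : ℝ) ≤ j := by exact_mod_cast hj
  have h1 := pow_le_pow_left₀ (by positivity) (one_add_mul_exp_neg_le (x := (j : ℝ) / m)
    (by positivity)) k
  rw [mul_pow, ← Real.exp_nat_mul, ← Real.exp_nat_mul] at h1
  have h2 : (k : ℝ) * (-(((j : ℝ) / m) ^ 2 / (2 * (1 + (j : ℝ) / m)))) ≤ -2 * j := by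
    have : ((j : ℝ) / m) ^ 2 / (2 * (1 + (j : ℝ) / m)) = (j : ℝ) ^ 2 / (2 * m * (m + j)) := by
      field_simp
    rw [this, mul_neg, neg_mul, neg_le_neg_iff, ← mul_div_assoc, le_div_iff₀ (by positivity)]
    have h5 : (m : ℝ) + j ≤ 2 * m * j := by nlinarith
    calc 2 * (j : ℝ) * (2 * m * (m + j)) ≤ 2 * (j : ℝ) * (2 * m * (2 * m * j)) := by gcongr
      _ ≤ 11 * (m : ℝ) ^ 2 * j ^ 2 := by nlinarith [sq_nonneg ((m : ℝ) * j)]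
      _ ≤ _ := by gcongr
  have h3 : ((m + j : ℕ) : ℝ) ^ k = (m : ℝ) ^ k * (1 + (j : ℝ) / m) ^ k := by
    rw [← mul_pow]; congr 1; push_cast; field_simp
  have h4 : Real.exp (-s) ^ j ≤ Real.exp (k * -((j : ℝ) / m)) := by
    rw [← Real.exp_nat_mul, Real.exp_le_exp]
    have := mul_le_mul_of_nonneg_left hs (by positivity : (0 : ℝ) ≤ j)
    have e : (k : ℝ) * -((j : ℝ) / m) = -(j * (k / m)) := by ring
    rw [e]; linarith
  calc ((m + j : ℕ) : ℝ) ^ k * Real.exp (-s) ^ (m + j)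
      = (m : ℝ) ^ k * Real.exp (-s) ^ m * ((1 + (j : ℝ) / m) ^ k * Real.exp (-s) ^ j) := by
        rw [h3, pow_add]; ring
    _ ≤ (m : ℝ) ^ k * Real.exp (-s) ^ m * Real.exp (-2 * j) := by
        gcongr
        refine (mul_le_mul_of_nonneg_left h4 (by positivity)).trans (h1.trans ?_)
        exact Real.exp_le_exp.2 h2
    _ = _ := by rw [← Real.exp_nat_mul (-2), mul_comm (-2 : ℝ)]

/-- To the left of `m`, the weight `a ^ k * exp (-s * a)` decays geometrically. -/
theorem weight_sub_le {k m : ℕ} (hm : 1 ≤ m) (hk : 11 * m ^ 2 ≤ k) {s : ℝ}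
    (hs : s ≤ ((k : ℝ) + 1) / m) {i : ℕ} (hi : i < m) :
    (i : ℝ) ^ k * Real.exp (-s) ^ i ≤
      (m : ℝ) ^ k * Real.exp (-s) ^ m * Real.exp (-2) ^ (m - i) := by
  have hm0 : (0 : ℝ) < m := by exact_mod_cast hm
  have hm1 : (1 : ℝ) ≤ m := by exact_mod_cast hm
  have hk' : 11 * (m : ℝ) ^ 2 ≤ k := by exact_mod_cast hk
  rcases Nat.eq_zero_or_pos i with rfl | hi0
  · have : k ≠ 0 := by nlinarith
    simp only [Nat.cast_zero, zero_pow this, zero_mul]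
    positivity
  obtain ⟨j, rfl⟩ : ∃ j, m = i + j := ⟨m - i, by omega⟩
  have hj1 : (1 : ℝ) ≤ j := by exact_mod_cast (by omega : 1 ≤ j)
  have hi1 : (1 : ℝ) ≤ i := by exact_mod_cast hi0
  rw [Nat.add_sub_cancel_left]
  set M : ℝ := ((i + j : ℕ) : ℝ) with hM
  have hMij : M = i + j := by rw [hM]; push_cast; ring
  have hx1 : (j : ℝ) / M < 1 := by rw [div_lt_one hm0]; linarith
  have h1 := pow_le_pow_left₀ (mul_nonneg (by linarith) (Real.exp_pos _).le)
    (one_sub_mul_exp_le (x := (j : ℝ) / M) (by positivity) hx1) k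
  rw [mul_pow, ← Real.exp_nat_mul, ← Real.exp_nat_mul] at h1
  have h3 : (i : ℝ) ^ k = M ^ k * (1 - (j : ℝ) / M) ^ k := by
    rw [← mul_pow]; congr 1; field_simp; linarith
  have h2 : (k : ℝ) * (-(((j : ℝ) / M) ^ 2 / 2)) ≤ -3 * j := by
    rw [div_pow, div_div, mul_neg, neg_mul, neg_le_neg_iff, ← mul_div_assoc,
      le_div_iff₀ (by positivity)]
    calc 3 * (j : ℝ) * (M ^ 2 * 2) ≤ 11 * M ^ 2 * j ^ 2 := by
          have : (j : ℝ) ≤ j ^ 2 := by nlinarith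
          nlinarith [sq_nonneg M, mul_le_mul_of_nonneg_left this (sq_nonneg M)]
      _ ≤ _ := by gcongr
  have h4 : 1 ≤ Real.exp (-s) ^ j * Real.exp (k * ((j : ℝ) / M)) * Real.exp j := by
    rw [← Real.exp_nat_mul, ← Real.exp_add, ← Real.exp_add, Real.one_le_exp_iff]
    have h5 := mul_le_mul_of_nonneg_left hs (by positivity : (0 : ℝ) ≤ j)
    have h6 : (j : ℝ) * ((k + 1) / M) = k * (j / M) + j / M := by ring
    have h7 : (j : ℝ) / M ≤ j := div_le_self (by positivity) hm1
    linarith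
  have hpos : 0 ≤ 1 - (j : ℝ) / M := by linarith
  calc (i : ℝ) ^ k * Real.exp (-s) ^ i
      = M ^ k * (1 - (j : ℝ) / M) ^ k * Real.exp (-s) ^ i * 1 := by rw [h3, mul_one]
    _ ≤ M ^ k * (1 - (j : ℝ) / M) ^ k * Real.exp (-s) ^ i *
        (Real.exp (-s) ^ j * Real.exp (k * ((j : ℝ) / M)) * Real.exp j) := by gcongr
    _ = M ^ k * Real.exp (-s) ^ (i + j) *
        ((1 - (j : ℝ) / M) ^ k * Real.exp (k * ((j : ℝ) / M)) * Real.exp j) := by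
        rw [pow_add]; ring
    _ ≤ M ^ k * Real.exp (-s) ^ (i + j) * (Real.exp (-3 * j) * Real.exp j) := by
        gcongr
        exact h1.trans (Real.exp_le_exp.2 h2)
    _ = _ := by
        rw [← Real.exp_add, ← Real.exp_nat_mul (-2), show -3 * (j : ℝ) + j = j * -2 by ring]

theorem exp_neg_two_le : Real.exp (-2) ≤ 1 / 4 := by
  have h := Real.exp_one_gt_two
  have h2 : Real.exp 2 = Real.exp 1 * Real.exp 1 := by rw [← Real.exp_add]; norm_num
  rw [Real.exp_neg, ← one_div]
  refine one_div_le_one_div_of_le (by norm_num) ?_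
  nlinarith

/-- If `k` is large compared to `m ^ 2`, the alternating sum is dominated by its `m`-th term. -/
theorem abs_tsum_sub_main_le {k m : ℕ} (hm : 1 ≤ m) (hk : 11 * m ^ 2 ≤ k) {s : ℝ}
    (hs : (k : ℝ) / m ≤ s) (hs' : s ≤ ((k : ℝ) + 1) / m) :
    |(∑' a : ℕ, (a : ℝ) ^ k * (-Real.exp (-s)) ^ a) - (-1) ^ m * ((m : ℝ) ^ k * Real.exp (-s) ^ m)|
      ≤ 2 / 3 * ((m : ℝ) ^ k * Real.exp (-s) ^ m) := by
  have hm0 : (0 : ℝ) < m := by exact_mod_cast hm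
  have hk0 : (0 : ℝ) < k := by
    have : 0 < k := by nlinarith
    exact_mod_cast this
  have hs0 : 0 < s := lt_of_lt_of_le (by positivity) hs
  set M := (m : ℝ) ^ k * Real.exp (-s) ^ m with hM
  have hM0 : 0 ≤ M := by positivity
  set r := Real.exp (-2) with hr
  have hr0 : 0 < r := Real.exp_pos _
  have hr4 : r ≤ 1 / 4 := exp_neg_two_le
  have hgeo : HasSum (fun j : ℕ => M * (r * r ^ j)) (M * (r * (1 - r)⁻¹)) :=
    ((hasSum_geometric_of_lt_one hr0.le (by linarith)).mul_left r).mul_left M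
  have hrr : r * (1 - r)⁻¹ ≤ 1 / 3 := by
    rw [← div_eq_mul_inv, div_le_div_iff₀ (by linarith) (by norm_num)]; linarith
  set f : ℕ → ℝ := fun a => (a : ℝ) ^ k * (-Real.exp (-s)) ^ a with hf
  have hnorm : ∀ a, ‖f a‖ = (a : ℝ) ^ k * Real.exp (-s) ^ a := fun a => by simp [hf]
  have hsum : Summable f := summable_pow_mul_geometric_of_norm_lt_one k (by simpa using hs0)
  have h1 := hsum.sum_add_tsum_nat_add (m + 1)
  rw [sum_range_succ] at h1
  have hfm : f m = (-1) ^ m * M := by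
    simp only [hf, hM]; rw [neg_pow]; ring
  have hleft : ‖∑ i ∈ range m, f i‖ ≤ M * (r * (1 - r)⁻¹) := by
    calc ‖∑ i ∈ range m, f i‖ ≤ ∑ i ∈ range m, M * (r * r ^ (m - 1 - i)) := by
          refine norm_sum_le_of_le _ fun i hi => ?_
          rw [hnorm, ← pow_succ']
          have hi' := mem_range.1 hi
          rw [show m - 1 - i + 1 = m - i by omega]
          exact weight_sub_le hm hk hs' hi'
      _ = ∑ i ∈ range m, M * (r * r ^ i) :=
          sum_range_reflect (fun i => M * (r * r ^ i)) m
      _ ≤ _ := sum_le_hasSum _ (fun i _ => by positivity) hgeo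
  have hright : ‖∑' i, f (i + (m + 1))‖ ≤ M * (r * (1 - r)⁻¹) := by
    refine tsum_of_norm_bounded hgeo fun i => ?_
    rw [hnorm, ← pow_succ', show i + (m + 1) = m + (i + 1) by omega]
    exact weight_add_le hm hk hs (i + 1)
  rw [← h1, hfm, show ∑ i ∈ range m, f i + (-1) ^ m * M + ∑' i, f (i + (m + 1)) - (-1) ^ m * M
    = ∑ i ∈ range m, f i + ∑' i, f (i + (m + 1)) by ring]
  refine (abs_add_le _ _).trans ?_
  rw [Real.norm_eq_abs] at hleft hright
  have := mul_le_mul_of_nonneg_left hrr hM0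
  linarith

/-- If `k` is large compared to `m ^ 2`, the summands with `d ≥ 2` are negligible. -/
theorem mul_tsum_le_of_large {k m : ℕ} (hm : 1 ≤ m) (hk : 11 * m ^ 2 ≤ k) {s : ℝ}
    (hs : (k : ℝ) / m ≤ s) (hs' : s ≤ ((k : ℝ) + 1) / m) (d : ℕ) :
    ((d : ℝ) + 2) * ∑' a : ℕ, (a : ℝ) ^ k * Real.exp (-(((d : ℝ) + 2) * s)) ^ a
      ≤ (m : ℝ) ^ k * Real.exp (-s) ^ m * (1 / 10 * (1 / 2) ^ d) := by
  have hm0 : (0 : ℝ) < m := by exact_mod_cast hm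
  have hm1 : (1 : ℝ) ≤ m := by exact_mod_cast hm
  have hk' : 11 * (m : ℝ) ^ 2 ≤ k := by exact_mod_cast hk
  have hk0 : 0 < k := by nlinarith
  have hs11 : 11 ≤ s := by
    refine le_trans ?_ hs
    rw [le_div_iff₀ hm0]; nlinarith
  set r := Real.exp (-(((d : ℝ) + 1) * s)) with hr
  have hr0 : 0 < r := Real.exp_pos _
  have hrle : r ≤ (1 / 2048) * (1 / 2048) ^ d := by
    rw [← pow_succ']
    have : Real.exp (-11) ≤ 1 / 2048 := by
      rw [Real.exp_neg, ← one_div]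
      refine one_div_le_one_div_of_le (by norm_num) ?_
      have h := pow_le_pow_left₀ (by norm_num) Real.exp_one_gt_two.le 11
      rw [← Real.exp_nat_mul] at h
      norm_num at h
      exact h
    calc r ≤ Real.exp (-11) ^ (d + 1) := by
          rw [← Real.exp_nat_mul, hr, Real.exp_le_exp]; push_cast
          nlinarith [mul_le_mul_of_nonneg_left hs11 (by positivity : (0 : ℝ) ≤ d + 1)]
      _ ≤ _ := by gcongr
  have hr2 : r ≤ 1 / 2 := by
    have : ((1 : ℝ) / 2048) ^ d ≤ 1 := pow_le_one₀ (by norm_num) (by norm_num)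
    linarith
  have hsum : Summable fun a : ℕ => (a : ℝ) ^ k * Real.exp (-(((d : ℝ) + 2) * s)) ^ a := by
    refine summable_pow_mul_geometric_of_norm_lt_one k ?_
    have : 0 < ((d : ℝ) + 2) * s := by positivity
    simpa using this
  have hgeo : HasSum (fun j : ℕ => (m : ℝ) ^ k * Real.exp (-k) * (r * r ^ j))
      ((m : ℝ) ^ k * Real.exp (-k) * (r * (1 - r)⁻¹)) :=
    ((hasSum_geometric_of_lt_one hr0.le (by linarith)).mul_left r).mul_left _
  have hterm : ∀ a : ℕ, ((a + 1 : ℕ) : ℝ) ^ k * Real.exp (-(((d : ℝ) + 2) * s)) ^ (a + 1)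
      ≤ (m : ℝ) ^ k * Real.exp (-k) * (r * r ^ a) := by
    intro a
    set b : ℝ := ((a + 1 : ℕ) : ℝ) with hb
    have h1 : b ≤ m * Real.exp (b / m - 1) := by
      have := Real.add_one_le_exp (b / m - 1)
      calc b = m * (b / m - 1 + 1) := by field_simp; ring
        _ ≤ _ := by gcongr
    calc b ^ k * Real.exp (-(((d : ℝ) + 2) * s)) ^ (a + 1)
        ≤ (m * Real.exp (b / m - 1)) ^ k * Real.exp (-(((d : ℝ) + 2) * s)) ^ (a + 1) := by gcongr
      _ = (m : ℝ) ^ k * Real.exp (k * (b / m - 1) + b * (-(((d : ℝ) + 2) * s))) := by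
          rw [mul_pow, ← Real.exp_nat_mul, ← Real.exp_nat_mul, ← hb, mul_assoc, ← Real.exp_add]
      _ ≤ (m : ℝ) ^ k * Real.exp (-k + b * (-(((d : ℝ) + 1) * s))) := by
          refine mul_le_mul_of_nonneg_left (Real.exp_le_exp.2 ?_) (by positivity)
          have h2 := mul_le_mul_of_nonneg_left hs (by positivity : 0 ≤ b)
          have h3 : (k : ℝ) * (b / m - 1) = b * (k / m) - k := by ring
          rw [h3]; linarith
      _ = _ := by
          rw [← pow_succ', hr, ← Real.exp_nat_mul, ← hb, mul_assoc, ← Real.exp_add]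
  have h3 : ∑' a : ℕ, (a : ℝ) ^ k * Real.exp (-(((d : ℝ) + 2) * s)) ^ a
      ≤ (m : ℝ) ^ k * Real.exp (-k) * (r * (1 - r)⁻¹) := by
    rw [hsum.tsum_eq_zero_add]
    simp only [Nat.cast_zero, zero_pow hk0.ne', zero_mul, zero_add]
    exact hasSum_le hterm ((summable_nat_add_iff 1).2 hsum).hasSum hgeo
  have h4 : r * (1 - r)⁻¹ ≤ 2 * r := by
    rw [← div_eq_mul_inv, div_le_iff₀ (by linarith)]; nlinarith
  have h5 : Real.exp (-k) ≤ 3 * Real.exp (-s) ^ m := by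
    have h6 : Real.exp (-k) = Real.exp 1 * Real.exp (-(k + 1)) := by
      rw [← Real.exp_add]; congr 1; ring
    have h7 : Real.exp (-((k : ℝ) + 1)) ≤ Real.exp (-s) ^ m := by
      rw [← Real.exp_nat_mul, Real.exp_le_exp]
      rw [le_div_iff₀ hm0] at hs'
      linarith
    rw [h6]
    exact mul_le_mul Real.exp_one_lt_three.le h7 (Real.exp_pos _).le (by norm_num)
  have h8 : (d : ℝ) + 2 ≤ 2 * 2 ^ d := by
    have : ∀ n : ℕ, n + 2 ≤ 2 * 2 ^ n := fun n => by
      induction n with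
      | zero => norm_num
      | succ n ih => rw [pow_succ]; omega
    exact_mod_cast this d
  calc _ ≤ (2 * 2 ^ d) * ((m : ℝ) ^ k * (3 * Real.exp (-s) ^ m) *
        (2 * ((1 / 2048) * (1 / 2048) ^ d))) := by
        gcongr
        exact h3.trans (mul_le_mul (mul_le_mul_of_nonneg_left h5 (by positivity))
          (by linarith) (mul_nonneg hr0.le (inv_nonneg.2 (by linarith))) (by positivity))
    _ = (m : ℝ) ^ k * Real.exp (-s) ^ m * (12 / 2048 * (2 * (1 / 2048)) ^ d) := by
        rw [mul_pow]; ring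
    _ ≤ _ := by
        refine mul_le_mul_of_nonneg_left (mul_le_mul (by norm_num) ?_ (by positivity) (by norm_num))
          (by positivity)
        exact pow_le_pow_left₀ (by norm_num) (by norm_num) d
theorem neg_two_pi_I_mul_half_add {θ : ℝ} (hs : Real.sin θ ≠ 0) :
    -2 * Real.pi * Complex.I * (1 / 2 + (Real.cot θ / 2) * Complex.I) =
      ((Real.pi / Real.sin θ : ℝ) : ℂ) * Complex.exp (((-θ : ℝ) : ℂ) * Complex.I) := by
  rw [Complex.exp_mul_I, ← Complex.ofReal_cos, ← Complex.ofReal_sin, Real.cos_neg, Real.sin_neg,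
    Real.cot_eq_cos_div_sin]
  have hs' : (Real.sin θ : ℂ) ≠ 0 := by exact_mod_cast hs
  push_cast at hs' ⊢
  field_simp
  linear_combination (-Complex.cos θ) * Complex.I_sq

theorem neg_two_pi_I_mul_half_add_sub_one {θ : ℝ} (hs : Real.sin θ ≠ 0) :
    -2 * Real.pi * Complex.I * (1 / 2 + (Real.cot θ / 2) * Complex.I - 1) =
      ((Real.pi / Real.sin θ : ℝ) : ℂ) * Complex.exp ((θ : ℂ) * Complex.I) := by
  rw [Complex.exp_mul_I, ← Complex.ofReal_cos, ← Complex.ofReal_sin,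
    Real.cot_eq_cos_div_sin]
  have hs' : (Real.sin θ : ℂ) ≠ 0 := by exact_mod_cast hs
  push_cast at hs' ⊢
  field_simp
  linear_combination (-Complex.cos θ) * Complex.I_sq

theorem exp_mul_I_pow_of_mul_eq {θ : ℝ} {N : ℕ} {m : ℤ} (h : N * θ = m * Real.pi) :
    Complex.exp ((θ : ℂ) * Complex.I) ^ N = (-1) ^ m := by
  rw [← Complex.exp_nat_mul, ← Complex.exp_pi_mul_I, ← Complex.exp_int_mul]
  congr 1
  have h' : (N : ℂ) * θ = m * Real.pi := by exact_mod_cast h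
  linear_combination Complex.I * h'

theorem norm_sq_neg_two_pi_I_mul {θ : ℝ} (hs : Real.sin θ ≠ 0) (n : ℤ) :
    ‖-2 * Real.pi * Complex.I * (1 / 2 + (Real.cot θ / 2) * Complex.I + n)‖ ^ 2 =
      (Real.pi / Real.sin θ) ^ 2 * (1 + 4 * (n * (n + 1)) * Real.sin θ ^ 2) := by
  have h1 (c : ℝ) : -2 * Real.pi * Complex.I * (1 / 2 + (c / 2) * Complex.I + n) =
      ((Real.pi * c : ℝ) : ℂ) + ((-(2 * Real.pi * (1 / 2 + n)) : ℝ) : ℂ) * Complex.I := by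
    push_cast
    linear_combination (-Real.pi * c : ℂ) * Complex.I_sq
  rw [h1, ← Complex.normSq_eq_norm_sq, Complex.normSq_add_mul_I, Real.cot_eq_cos_div_sin]
  field_simp
  linear_combination Real.sin_sq_add_cos_sq θ

/-- A form of Bernoulli's inequality for the terms of the Lipschitz series. -/
theorem two_mul_pow_three_le {N : ℕ} (hN : 6 ≤ N) {σ x n : ℝ} (hσ : 3 ≤ 4 * N * σ)
    (hx : 0 ≤ x) (hn : 0 ≤ (n - 1) * (n - 2)) (hn1 : 1 ≤ n)
    (h : x ^ 2 = 1 + 4 * (n * (n + 1)) * σ) : (2 * n) ^ 3 ≤ x ^ N := by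
  have hN0 : (6 : ℝ) ≤ N := by exact_mod_cast hN
  have hσ0 : 0 < σ := by
    by_contra hc
    push Not at hc
    nlinarith
  have hb := one_add_mul_self_le_rpow_one_add
    (s := 4 * (n * (n + 1)) * σ) (p := (N : ℝ) / 6)
    (by have : 0 ≤ 4 * (n * (n + 1)) * σ := by positivity
        linarith) (by linarith)
  have h1 : 2 * n ≤ (1 + 4 * (n * (n + 1)) * σ) ^ ((N : ℝ) / 6) := by
    refine le_trans ?_ hb
    have := mul_le_mul_of_nonneg_left hσ (by positivity : 0 ≤ n * (n + 1))
    nlinarith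
  have h2 := pow_le_pow_left₀ (by positivity) h1 6
  rw [← Real.rpow_natCast (_ ^ ((N : ℝ) / 6)) 6, ← Real.rpow_mul (by positivity),
    show (N : ℝ) / 6 * (6 : ℕ) = N by push_cast; ring, Real.rpow_natCast, ← h] at h2
  refine (pow_le_pow_iff_left₀ (by positivity) (by positivity) two_ne_zero).1 ?_
  calc ((2 * n) ^ 3) ^ 2 = (2 * n) ^ 6 := by ring
    _ ≤ _ := h2
    _ = _ := by rw [← pow_mul, ← pow_mul, mul_comm]

/-- A series whose terms beyond the first are dominated by `1 / (8 n ^ 2)`. -/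
theorem summable_and_norm_tsum_sub_le {f : ℕ → ℂ}
    (h : ∀ n : ℕ, ‖f (n + 1)‖ ≤ 1 / 8 * (1 / ((n + 1 : ℕ) : ℝ) ^ 2)) :
    Summable f ∧ ‖∑' n, f n - f 0‖ ≤ Real.pi ^ 2 / 48 := by
  have hz := (hasSum_nat_add_iff' 1).2 hasSum_zeta_two
  simp only [sum_range_one, Nat.cast_zero] at hz
  norm_num at hz
  have hz' : HasSum (fun n : ℕ => 1 / 8 * (1 / ((n + 1 : ℕ) : ℝ) ^ 2)) (1 / 8 * (Real.pi ^ 2 / 6)) := by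
    simpa only [one_div, Nat.cast_add, Nat.cast_one] using hz.mul_left (8⁻¹ : ℝ)
  have hs : Summable f := (summable_nat_add_iff 1).1 (Summable.of_norm_bounded hz'.summable h)
  refine ⟨hs, ?_⟩
  rw [hs.tsum_eq_zero_add, add_sub_cancel_left]
  exact (tsum_of_norm_bounded hz' h).trans (by linarith)

/-- Via Lipschitz' formula, the sum over `a` is close to its two dominant lattice terms. -/
theorem abs_lipschitz_sub_le {k m : ℕ} {θ : ℝ} (hk : 5 ≤ k) (hθ0 : 0 < θ) (hθ : θ < Real.pi / 2)
    (hm : ((k + 1 : ℕ) : ℝ) * θ = m * Real.pi) (hσ : 3 ≤ 4 * ((k + 1 : ℕ) : ℝ) * Real.sin θ ^ 2) :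
    |(Real.pi / Real.sin θ) ^ (k + 1) / k.factorial *
        (∑' a : ℕ, (a : ℝ) ^ k * (-Real.exp (-(Real.pi * Real.cot θ))) ^ a) - 2 * (-1) ^ m|
      ≤ Real.pi ^ 2 / 24 := by
  have hsin : 0 < Real.sin θ := Real.sin_pos_of_pos_of_lt_pi hθ0 (by linarith [Real.pi_pos])
  have hcos : 0 < Real.cos θ := Real.cos_pos_of_mem_Ioo ⟨by linarith, hθ⟩
  have hcot : 0 < Real.cot θ := by rw [Real.cot_eq_cos_div_sin]; positivity
  set A : ℝ := Real.pi / Real.sin θ with hA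
  have hA0 : 0 < A := div_pos Real.pi_pos hsin
  set z : ℂ := 1 / 2 + (Real.cot θ / 2) * Complex.I with hz
  have hzim : 0 < z.im := by simp [hz]; positivity
  set g : ℤ → ℂ := fun n => (A : ℂ) ^ (k + 1) / (-2 * Real.pi * Complex.I * (z + n)) ^ (k + 1) with hg
  have hA0' : (A : ℂ) ≠ 0 := by exact_mod_cast hA0.ne'
  have hmz : ((k + 1 : ℕ) : ℝ) * θ = (m : ℤ) * Real.pi := by exact_mod_cast hm
  have hmz' : ((k + 1 : ℕ) : ℝ) * (-θ) = (-m : ℤ) * Real.pi := by push_cast at hm ⊢; linarith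
  have hg0 : g 0 = (-1) ^ m := by
    simp only [hg, Int.cast_zero, add_zero]
    rw [hz, neg_two_pi_I_mul_half_add hsin.ne', mul_pow, exp_mul_I_pow_of_mul_eq hmz', ← hA]
    rw [div_mul_cancel_left₀ (pow_ne_zero _ hA0')]
    simp
  have hg1 : g (-1) = (-1) ^ m := by
    simp only [hg, Int.cast_neg, Int.cast_one, ← sub_eq_add_neg]
    rw [hz, neg_two_pi_I_mul_half_add_sub_one hsin.ne', mul_pow, exp_mul_I_pow_of_mul_eq hmz, ← hA]
    rw [div_mul_cancel_left₀ (pow_ne_zero _ hA0')]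
    rw [zpow_natCast, ← inv_pow]; norm_num
  have hgn : ∀ (n : ℕ) (l : ℤ), l * (l + 1) = ((n + 1 : ℕ) : ℤ) * ((n + 1 : ℕ) + 1) →
      ‖g l‖ ≤ 1 / 8 * (1 / ((n + 1 : ℕ) : ℝ) ^ 2) := by
    intro n l hl
    have h1 := norm_sq_neg_two_pi_I_mul hsin.ne' l
    rw [← hz, ← hA] at h1
    have hl' : (l : ℝ) * (l + 1) = ((n + 1 : ℕ) : ℝ) * ((n + 1 : ℕ) + 1) := by exact_mod_cast hl
    rw [hl'] at h1
    set w := ‖-2 * Real.pi * Complex.I * (z + l)‖ with hw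
    set x : ℝ := ((n + 1 : ℕ) : ℝ) with hx
    have hx1 : 1 ≤ x := by rw [hx]; push_cast; linarith [n.cast_nonneg (α := ℝ)]
    have h2 : (2 * x) ^ 3 ≤ (w / A) ^ (k + 1) := by
      refine two_mul_pow_three_le (by omega) hσ (by positivity) ?_ hx1 ?_
      · rcases n with _ | n
        · simp [hx]
        · rw [hx]; push_cast
          have := n.cast_nonneg (α := ℝ)
          nlinarith
      · rw [div_pow, h1]; field_simp
    have h3 : ‖g l‖ = 1 / (w / A) ^ (k + 1) := by
      simp only [hg]
      rw [norm_div, norm_pow, norm_pow, ← hw, Complex.norm_real, Real.norm_of_nonneg hA0.le,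
        div_pow w, one_div_div]
    rw [h3]
    calc 1 / (w / A) ^ (k + 1) ≤ 1 / (2 * x) ^ 3 := one_div_le_one_div_of_le (by positivity) h2
      _ ≤ 1 / (8 * x ^ 2) := by
          refine one_div_le_one_div_of_le (by positivity) ?_
          nlinarith [mul_le_mul_of_nonneg_left hx1 (sq_nonneg x)]
      _ = _ := by field_simp
  obtain ⟨hp1, hp2⟩ := summable_and_norm_tsum_sub_le (f := fun n : ℕ => g n) fun n =>
    hgn n _ (by push_cast; ring)
  obtain ⟨hq1, hq2⟩ := summable_and_norm_tsum_sub_le (f := fun n : ℕ => g (-(n + 1))) fun n =>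
    hgn n _ (by push_cast; ring)
  have htot := (hp1.hasSum.of_nat_of_neg_add_one hq1.hasSum).tsum_eq
  have hlip := EisensteinSeries.qExpansion_identity (k := k) (by omega) ⟨z, hzim⟩
  have hT : ((A ^ (k + 1) / k.factorial *
        (∑' a : ℕ, (a : ℝ) ^ k * (-Real.exp (-(Real.pi * Real.cot θ))) ^ a) : ℝ) : ℂ)
      = ∑' n : ℤ, g n := by
    simp only at hlip
    rw [hz, exp_two_pi_I_mul_half_add, ← hz] at hlip
    have hg' : ∀ n : ℤ, g n = (A : ℂ) ^ (k + 1) / (-2 * Real.pi * Complex.I) ^ (k + 1) *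
        (1 / (z + n) ^ (k + 1)) := fun n => by
      simp only [hg]; rw [mul_pow _ (z + n), div_mul_div_comm, mul_one]
    rw [tsum_congr hg', tsum_mul_left, hlip]
    push_cast
    have : (-2 * Real.pi * Complex.I : ℂ) ≠ 0 := by simp [Real.pi_ne_zero]
    field_simp
  rw [← Real.norm_eq_abs, ← Complex.norm_real, Complex.ofReal_sub, hT, htot]
  simp only [Nat.cast_zero, zero_add, hg0, hg1] at hp2 hq2
  push_cast
  calc _ = ‖(∑' n : ℕ, g n - (-1) ^ m) + (∑' n : ℕ, g (-(n + 1)) - (-1) ^ m)‖ := by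
        congr 1; ring
    _ ≤ _ := (norm_add_le _ _).trans (by linarith)

theorem mul_pow_sub_six_le {u : ℝ} (hu0 : 0 ≤ u) (hu : u ≤ 6 / 7) (j : ℕ) :
    ((6 + j : ℕ) : ℝ) * u ^ j ≤ 6 := by
  induction j with
  | zero => norm_num
  | succ j ih =>
    refine le_trans ?_ ih
    have : ((6 + (j + 1) : ℕ) : ℝ) * u ≤ ((6 + j : ℕ) : ℝ) := by
      push_cast
      nlinarith [j.cast_nonneg (α := ℝ)]
    calc ((6 + (j + 1) : ℕ) : ℝ) * u ^ (j + 1) = ((6 + (j + 1) : ℕ) : ℝ) * u * u ^ j := by ring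
      _ ≤ _ := by gcongr

theorem mul_one_div_pow_le {N : ℕ} (hN : 6 ≤ N) {c D : ℝ} (hc0 : 0 < c) (hc : 3 / 4 ≤ c ^ 2)
    (hD : 2 ≤ D) : N * (1 / (D * c)) ^ N ≤ 128 / 9 / D ^ 6 := by
  obtain ⟨j, rfl⟩ := Nat.exists_eq_add_of_le hN
  have hc1 : 7 / 12 ≤ c := by nlinarith
  have hu : 1 / (D * c) ≤ 6 / 7 := by
    rw [div_le_div_iff₀ (by positivity) (by norm_num)]; nlinarith
  have h1 := mul_pow_sub_six_le (by positivity) hu j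
  have h2 : 27 / 64 ≤ c ^ 6 := by
    calc (27 / 64 : ℝ) = (3 / 4) ^ 3 := by norm_num
      _ ≤ (c ^ 2) ^ 3 := by gcongr
      _ = _ := by ring
  calc ((6 + j : ℕ) : ℝ) * (1 / (D * c)) ^ (6 + j)
      = ((6 + j : ℕ) : ℝ) * (1 / (D * c)) ^ j * (1 / (D * c)) ^ 6 := by rw [pow_add]; ring
    _ ≤ 6 * (1 / (D * c)) ^ 6 := by gcongr
    _ = 6 / D ^ 6 / c ^ 6 := by rw [div_pow, mul_pow, one_pow]; field_simp
    _ ≤ 6 / D ^ 6 / (27 / 64) := by gcongr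
    _ = _ := by ring

/-- A majorant of `∑_{d ≥ 2} d ^ (-5)`. -/
theorem exists_hasSum_one_div_pow_five :
    ∃ b : ℝ, b ≤ 0.038 ∧ HasSum (fun d : ℕ => 1 / ((d : ℝ) + 2) ^ 5) b := by
  have h4 := (hasSum_nat_add_iff' 3).2 hasSum_zeta_four
  have hsum : Summable fun d : ℕ => 1 / ((d : ℝ) + 2) ^ 5 := by
    have := (summable_nat_add_iff 2).2 (Real.summable_one_div_nat_pow.2 (by norm_num : 1 < 5))
    simpa using this
  refine ⟨_, ?_, hsum.hasSum⟩
  rw [hsum.tsum_eq_zero_add]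
  have h5 : ∑' d : ℕ, 1 / (((d + 1 : ℕ) : ℝ) + 2) ^ 5
      ≤ 1 / 3 * (Real.pi ^ 4 / 90 - ∑ i ∈ range 3, 1 / (i : ℝ) ^ 4) := by
    refine hasSum_le (fun d => ?_) ((summable_nat_add_iff 1).2 hsum).hasSum (h4.mul_left (1 / 3))
    have e : (((d + 1 : ℕ) : ℝ) + 2) = ((d + 3 : ℕ) : ℝ) := by push_cast; ring
    rw [e, one_div_mul_one_div]
    refine one_div_le_one_div_of_le (by positivity) ?_
    rw [pow_succ _ 4, mul_comm]
    gcongr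
    push_cast
    linarith [d.cast_nonneg (α := ℝ)]
  norm_num [sum_range_succ] at h5 ⊢
  have hpi : Real.pi ^ 4 ≤ 3.1416 ^ 4 := by
    have := Real.pi_lt_d4.le
    have := Real.pi_pos
    gcongr
  norm_num at hpi
  linarith

theorem mul_tsum_le_of_cos {k : ℕ} (hk : 5 ≤ k) {A c : ℝ} (hA : 0 < A) (hc0 : 0 < c)
    (hc : 3 / 4 ≤ c ^ 2) (d : ℕ) :
    ((d : ℝ) + 2) * ∑' a : ℕ, (a : ℝ) ^ k * Real.exp (-(((d : ℝ) + 2) * (A * c))) ^ a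
      ≤ k.factorial / A ^ (k + 1) * (Real.exp 1 * (128 / 9)) * (1 / ((d : ℝ) + 2) ^ 5) := by
  set D : ℝ := (d : ℝ) + 2 with hD
  have hD2 : 2 ≤ D := by rw [hD]; linarith [d.cast_nonneg (α := ℝ)]
  have h1 := tsum_pow_mul_exp_le (k := k) (by omega) (s := D * (A * c)) (by positivity)
  have h2 := mul_one_div_pow_le (N := k + 1) (by omega) hc0 hc hD2
  calc _ ≤ D * (Real.exp 1 * (k + 1) * (k.factorial / (D * (A * c)) ^ (k + 1))) := by gcongr
    _ = k.factorial / A ^ (k + 1) * (Real.exp 1 * D) *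
        (((k + 1 : ℕ) : ℝ) * (1 / (D * c)) ^ (k + 1)) := by
        rw [show D * (A * c) = A * (D * c) by ring, mul_pow A, div_pow, one_pow]
        push_cast
        field_simp
    _ ≤ k.factorial / A ^ (k + 1) * (Real.exp 1 * D) * (128 / 9 / D ^ 6) := by gcongr
    _ = _ := by field_simp

theorem neg_one_pow_mul_pos_of_abs_sub_lt {m : ℕ} {x M : ℝ} (h : |x - (-1) ^ m * M| < M) :
    0 < (-1) ^ m * x := by
  rcases neg_one_pow_eq_or ℝ m with e | e <;> rw [e] at h ⊢ <;> rw [abs_lt] at h <;> linarith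

theorem neg_one_pow_mul_pos_of_large {k m : ℕ} (hm : 1 ≤ m) (hk : 11 * m ^ 2 ≤ k) {s : ℝ}
    (hs : (k : ℝ) / m ≤ s) (hs' : s ≤ ((k : ℝ) + 1) / m) :
    0 < (-1) ^ m * ∑' n : ℕ, (n : ℝ) * (∑ d ∈ n.divisors, (d : ℝ) ^ (k - 1)) *
      (-Real.exp (-s)) ^ n := by
  have hm0 : (0 : ℝ) < m := by exact_mod_cast hm
  have hk1 : 1 ≤ k := by nlinarith
  have hk0 : (0 : ℝ) < k := by exact_mod_cast hk1
  have hs0 : 0 < s := lt_of_lt_of_le (by positivity) hs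
  have h1 := abs_tsum_sub_le hs0 hk1 (hasSum_geometric_two.mul_left (1 / 10) |>.mul_left _)
    (mul_tsum_le_of_large hm hk hs hs')
  have h2 := abs_tsum_sub_main_le hm hk hs hs'
  have hM : 0 < (m : ℝ) ^ k * Real.exp (-s) ^ m := by positivity
  refine neg_one_pow_mul_pos_of_abs_sub_lt (M := (m : ℝ) ^ k * Real.exp (-s) ^ m) ?_
  refine (abs_sub_le _ _ _).trans_lt ((add_le_add h1 h2).trans_lt ?_)
  linarith

theorem neg_one_pow_mul_pos_of_small {k m : ℕ} {θ : ℝ} (hk : 5 ≤ k) (hθ0 : 0 < θ)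
    (hθ : θ ≤ Real.pi / 6) (hm : ((k + 1 : ℕ) : ℝ) * θ = m * Real.pi)
    (hσ : 3 ≤ 4 * ((k + 1 : ℕ) : ℝ) * Real.sin θ ^ 2) :
    0 < (-1) ^ m * ∑' n : ℕ, (n : ℝ) * (∑ d ∈ n.divisors, (d : ℝ) ^ (k - 1)) *
      (-Real.exp (-(Real.pi * Real.cot θ))) ^ n := by
  have hpi := Real.pi_pos
  have hsin : 0 < Real.sin θ := Real.sin_pos_of_pos_of_lt_pi hθ0 (by linarith)
  have hcos : √3 / 2 ≤ Real.cos θ := by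
    rw [← Real.cos_pi_div_six]
    exact Real.cos_le_cos_of_nonneg_of_le_pi hθ0.le (by linarith) hθ
  have hc0 : 0 < Real.cos θ := lt_of_lt_of_le (by positivity) hcos
  have hc : 3 / 4 ≤ Real.cos θ ^ 2 := by
    calc (3 / 4 : ℝ) = (√3 / 2) ^ 2 := by rw [div_pow, Real.sq_sqrt (by norm_num)]; norm_num
      _ ≤ _ := by gcongr
  have hA : 0 < Real.pi / Real.sin θ := by positivity
  have hs : Real.pi * Real.cot θ = Real.pi / Real.sin θ * Real.cos θ := by
    rw [Real.cot_eq_cos_div_sin]; ring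
  have h2 := abs_lipschitz_sub_le hk hθ0 (by linarith) hm hσ
  obtain ⟨b, hb, hB⟩ := exists_hasSum_one_div_pow_five
  rw [hs] at h2 ⊢
  have h1 := abs_tsum_sub_le (by positivity) (by omega) (hB.mul_left _)
    (mul_tsum_le_of_cos hk hA hc0 hc)
  set A := Real.pi / Real.sin θ
  set H := ∑' n : ℕ, (n : ℝ) * (∑ d ∈ n.divisors, (d : ℝ) ^ (k - 1)) *
      (-Real.exp (-(A * Real.cos θ))) ^ n
  set T := ∑' a : ℕ, (a : ℝ) ^ k * (-Real.exp (-(A * Real.cos θ))) ^ a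
  have hscale : 0 < A ^ (k + 1) / k.factorial := by positivity
  have h3 : |A ^ (k + 1) / k.factorial * H - A ^ (k + 1) / k.factorial * T|
      ≤ Real.exp 1 * (128 / 9) * b := by
    rw [← mul_sub, abs_mul, abs_of_pos hscale]
    refine (mul_le_mul_of_nonneg_left h1 hscale.le).trans (le_of_eq ?_)
    field_simp
  have h4 : 0 < (-1) ^ m * (A ^ (k + 1) / k.factorial * H) := by
    refine neg_one_pow_mul_pos_of_abs_sub_lt (M := 2) ?_
    rw [mul_comm _ (2 : ℝ)]
    refine (abs_sub_le _ _ _).trans_lt ((add_le_add h3 h2).trans_lt ?_)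
    have he := Real.exp_one_lt_d9
    have he' : Real.exp 1 * (128 / 9) * b ≤ 2.7183 * (128 / 9) * 0.038 := by
      have := Real.exp_pos 1
      refine mul_le_mul (by linarith) hb (hB.nonneg fun d => by positivity) (by norm_num)
    have hp : Real.pi ^ 2 ≤ 3.15 ^ 2 := by
      have := Real.pi_lt_d2.le
      gcongr
    norm_num at he' hp
    linarith
  rw [mul_left_comm] at h4
  exact pos_of_mul_pos_right h4 hscale.le

theorem stmt8 (k m : ℕ) (hk2 : 2 ≤ k) (hm1 : 1 ≤ m) (hm : m ≤ (k + 1) / 6) :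
    ∃ r : ℝ, 0 < r ∧
      hfun k (1 / 2 + (Real.cot (m * Real.pi / (k + 1)) / 2) * Complex.I)
        = (((-1 : ℝ) ^ m * r : ℝ) : ℂ) := by
  have hpi := Real.pi_pos
  have hpi3 := Real.pi_gt_d2
  have hpi4 := Real.pi_lt_d2
  set θ : ℝ := m * Real.pi / (k + 1) with hθdef
  have hm0 : (0 : ℝ) < m := by exact_mod_cast hm1
  have hkm : 6 * (m : ℝ) ≤ k + 1 := by exact_mod_cast (by omega : 6 * m ≤ k + 1)
  have hθ0 : 0 < θ := by positivity
  have hθ : θ ≤ Real.pi / 6 := by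
    rw [hθdef, div_le_div_iff₀ (by positivity) (by norm_num)]; nlinarith
  have hNθ : ((k + 1 : ℕ) : ℝ) * θ = m * Real.pi := by rw [hθdef]; push_cast; field_simp
  have hsin : 0 < Real.sin θ := Real.sin_pos_of_pos_of_lt_pi hθ0 (by linarith)
  rw [hfun_half_add]
  suffices h : 0 < (-1) ^ m * ∑' n : ℕ, (n : ℝ) * (∑ d ∈ n.divisors, (d : ℝ) ^ (k - 1)) *
      (-Real.exp (-(Real.pi * Real.cot θ))) ^ n by
    refine ⟨_, h, ?_⟩
    rw [← mul_assoc, ← mul_pow, neg_one_mul, neg_neg, one_pow, one_mul]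
  rcases le_or_gt (11 * m ^ 2) k with hbig | hsmall
  · have hbig' : 11 * (m : ℝ) ^ 2 ≤ k := by exact_mod_cast hbig
    have hpt : Real.pi / θ = (k + 1) / m := by rw [hθdef]; field_simp
    refine neg_one_pow_mul_pos_of_large hm1 hbig ?_ ?_
    · have h1 : 1 / θ - θ / 2 ≤ Real.cot θ := by
        rw [Real.cot_eq_cos_div_sin, le_div_iff₀ hsin]
        have h2 := Real.one_sub_sq_div_two_le_cos (x := θ)
        have h3 := Real.sin_le hθ0.le
        have h4 : 0 ≤ 1 / θ - θ / 2 := by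
          rw [sub_nonneg, div_le_div_iff₀ (by norm_num) hθ0]; nlinarith
        calc (1 / θ - θ / 2) * Real.sin θ ≤ (1 / θ - θ / 2) * θ := by gcongr
          _ = 1 - θ ^ 2 / 2 := by field_simp
          _ ≤ _ := h2
      have h5 : Real.pi * (1 / θ - θ / 2) = (k + 1) / m - m * Real.pi ^ 2 / (2 * (k + 1)) := by
        rw [mul_sub, mul_one_div, hpt, hθdef]; field_simp
      have h6 : m * Real.pi ^ 2 / (2 * ((k : ℝ) + 1)) ≤ 1 / m := by
        rw [div_le_div_iff₀ (by positivity) hm0]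
        have : Real.pi ^ 2 ≤ 10 := by nlinarith
        nlinarith [mul_le_mul_of_nonneg_left this (sq_nonneg (m : ℝ))]
      have h7 := mul_le_mul_of_nonneg_left h1 hpi.le
      rw [h5, add_div] at h7
      linarith
    · rw [← hpt, div_eq_mul_one_div]
      gcongr
      rw [Real.cot_eq_cos_div_sin, ← inv_div, ← Real.tan_eq_sin_div_cos, ← one_div]
      exact one_div_le_one_div_of_le hθ0 (Real.le_tan hθ0.le (by linarith))
  · refine neg_one_pow_mul_pos_of_small (by omega) hθ0 hθ hNθ ?_
    have hs : 0.93 * θ ≤ Real.sin θ := by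
      have := Real.sin_gt_sub_cube hθ0
      have h1 : θ ^ 2 ≤ 0.28 := by nlinarith
      nlinarith [mul_le_mul_of_nonneg_left h1 hθ0.le]
    have hs2 : (0.93 * θ) ^ 2 ≤ Real.sin θ ^ 2 := by gcongr
    have hN : ((k + 1 : ℕ) : ℝ) ≤ 11 * (m : ℝ) ^ 2 := by exact_mod_cast hsmall
    have hN0 : (0 : ℝ) < ((k + 1 : ℕ) : ℝ) := by positivity
    have h2 : ((k + 1 : ℕ) : ℝ) * θ ^ 2 = m ^ 2 * Real.pi ^ 2 / ((k + 1 : ℕ) : ℝ) := by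
      rw [eq_div_iff hN0.ne', ← mul_pow, ← hNθ]; ring
    have h3 : 9.85 / 11 ≤ m ^ 2 * Real.pi ^ 2 / ((k + 1 : ℕ) : ℝ) := by
      rw [div_le_div_iff₀ (by norm_num) hN0]
      have : 9.85 ≤ Real.pi ^ 2 := by nlinarith
      nlinarith [mul_le_mul_of_nonneg_left this (sq_nonneg (m : ℝ))]
    have h4 := mul_le_mul_of_nonneg_left hs2 hN0.le
    rw [← h2] at h3
    rw [mul_pow, ← mul_assoc, mul_comm _ (0.93 ^ 2 : ℝ), mul_assoc] at h4
    nlinarith
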